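/- Let A be a commutative ring and 𝔞 ⊆ A[x₁,…,xₙ] a nonzero ideal such that A[x₁,…,xₙ]/𝔞 is finitely generated as an A-module. If 𝔞 has a monic Gröbner basis with respect to some monomial order ≺, then there exists N ∈ ℕ such that A[x₁,…,xₙ]/𝔞 is isomorphic as an A-module to A^N. -/

import Mathlib

open MvPolynomial

namespace GB

variable {σ A : Type*} [CommRing A]

/-- Leading monomial (exponent vector) of `f` w.r.t. the monomial order `m`. -/
noncomputable def lm (m : MonomialOrder σ) (f : MvPolynomial σ A) : σ →₀ ℕ :=
  m.toSyn.symm (f.support.sup fun α => m.toSyn α)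

/-- Leading coefficient of `f` w.r.t. `m`. -/
noncomputable def lc (m : MonomialOrder σ) (f : MvPolynomial σ A) : A :=
  f.coeff (lm m f)

/-- Leading term of `f` w.r.t. `m`. -/
noncomputable def lt (m : MonomialOrder σ) (f : MvPolynomial σ A) : MvPolynomial σ A :=
  monomial (lm m f) (lc m f)

/-- `G` is a Gröbner basis of the ideal `I` w.r.t. the monomial order `m`:
`G ⊆ I` and `⟨lt f : f ∈ I, f ≠ 0⟩ = ⟨lt g : g ∈ G⟩`. -/
def IsGrobnerBasis (m : MonomialOrder σ) (I : Ideal (MvPolynomial σ A))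
    (G : Finset (MvPolynomial σ A)) : Prop :=
  (G : Set (MvPolynomial σ A)) ⊆ I ∧
    Ideal.span (lt m '' {f : MvPolynomial σ A | f ∈ I ∧ f ≠ 0}) =
      Ideal.span (lt m '' (G : Set (MvPolynomial σ A)))

/-- `G` is monic: every element has leading coefficient `1`. -/
def IsMonic (m : MonomialOrder σ) (G : Finset (MvPolynomial σ A)) : Prop :=
  ∀ g ∈ G, lc m g = 1

/-- The border of an order ideal `O` of monomials:
`∂O = (x₁·O ∪ ⋯ ∪ xₙ·O) \ O`. -/
def border {n : ℕ} (O : Set (Fin n →₀ ℕ)) : Set (Fin n →₀ ℕ) :=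
  (⋃ i : Fin n, (fun α => α + Finsupp.single i 1) '' O) \ O

end GB

namespace GB

variable {σ A : Type*} [CommRing A]

/-- The standard monomials of `G`: those divisible by no leading monomial of `G`. -/
def standardMonomials (m : MonomialOrder σ) (G : Finset (MvPolynomial σ A)) : Set (σ →₀ ℕ) :=
  {c | ∀ g ∈ G, ¬ lm m g ≤ c}

/-- The `A`-span of the standard monomials, mapped to the quotient by `I`. -/
noncomputable def standardToQuotient (m : MonomialOrder σ) (I : Ideal (MvPolynomial σ A))
    (G : Finset (MvPolynomial σ A)) :
    restrictSupport A (standardMonomials m G) →ₗ[A] MvPolynomial σ A ⧸ I :=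
  (Ideal.Quotient.mkₐ A I).toLinearMap ∘ₗ Submodule.subtype _

theorem standardToQuotient_surjective {m : MonomialOrder σ} {I : Ideal (MvPolynomial σ A)}
    {G : Finset (MvPolynomial σ A)} (hGI : (G : Set (MvPolynomial σ A)) ⊆ I)
    (hG : IsMonic m G) : Function.Surjective (standardToQuotient m I G) := by
  intro q
  obtain ⟨f, rfl⟩ := Ideal.Quotient.mk_surjective q
  have hunit : ∀ b ∈ (G : Set (MvPolynomial σ A)), IsUnit (m.leadingCoeff b) := fun b hb => by
    have h : m.leadingCoeff b = 1 := hG b hb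
    simp [h]
  obtain ⟨g, r, hfr, -, hr⟩ := m.div_set hunit f
  refine ⟨⟨r, fun c hc b hb => hr c hc b hb⟩, ?_⟩
  refine (Ideal.Quotient.eq (I := I)).2 ?_
  have hmem : Finsupp.linearCombination (MvPolynomial σ A)
      (fun b : (G : Set (MvPolynomial σ A)) => (b : MvPolynomial σ A)) g ∈ I := by
    rw [Finsupp.linearCombination_apply]
    exact I.sum_mem fun b _ => I.mul_mem_left _ (hGI b.2)
  rw [← neg_mem_iff]
  convert hmem using 1
  rw [neg_sub, sub_eq_iff_eq_add]
  exact hfr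

theorem IsGrobnerBasis.exists_lm_le {m : MonomialOrder σ} {I : Ideal (MvPolynomial σ A)}
    {G : Finset (MvPolynomial σ A)} (hGB : IsGrobnerBasis m I G) (hG : IsMonic m G)
    {f : MvPolynomial σ A} (hf : f ∈ I) (hf0 : f ≠ 0) : ∃ g ∈ G, lm m g ≤ lm m f := by
  have hlt : lt m f ∈ Ideal.span (lt m '' (G : Set (MvPolynomial σ A))) :=
    hGB.2 ▸ Ideal.subset_span ⟨f, ⟨hf, hf0⟩, rfl⟩
  have himage : lt m '' (G : Set (MvPolynomial σ A)) =
      (fun s => monomial s (1 : A)) '' (lm m '' (G : Set (MvPolynomial σ A))) := by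
    rw [Set.image_image]
    exact Set.image_congr fun g hg => by rw [lt, hG g hg]
  rw [himage, mem_ideal_span_monomial_image] at hlt
  have hlc : lc m f ≠ 0 := m.leadingCoeff_ne_zero_iff.2 hf0
  obtain ⟨_, ⟨g, hg, rfl⟩, hle⟩ := hlt (lm m f) (by
    classical rwa [mem_support_iff, lt, coeff_monomial, if_pos rfl])
  exact ⟨g, hg, hle⟩

theorem standardToQuotient_injective {m : MonomialOrder σ} {I : Ideal (MvPolynomial σ A)}
    {G : Finset (MvPolynomial σ A)} (hGB : IsGrobnerBasis m I G) (hG : IsMonic m G) :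
    Function.Injective (standardToQuotient m I G) := by
  rw [injective_iff_map_eq_zero]
  rintro ⟨f, hf⟩ hf0
  have hfI : f ∈ I := Ideal.Quotient.eq_zero_iff_mem.1 hf0
  by_contra hne
  have hfne : f ≠ 0 := fun h => hne (Subtype.ext h)
  obtain ⟨g, hg, hle⟩ := hGB.exists_lm_le hG hfI hfne
  exact hf (m.degree_mem_support hfne) g hg hle

/-- The standard monomials of a monic Gröbner basis form a basis of the quotient. -/
noncomputable def quotientBasis {m : MonomialOrder σ} {I : Ideal (MvPolynomial σ A)}
    {G : Finset (MvPolynomial σ A)} (hGB : IsGrobnerBasis m I G) (hG : IsMonic m G) :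
    Module.Basis (standardMonomials m G) A (MvPolynomial σ A ⧸ I) :=
  (basisRestrictSupport A (standardMonomials m G)).map
    (LinearEquiv.ofBijective (standardToQuotient m I G)
      ⟨standardToQuotient_injective hGB hG, standardToQuotient_surjective hGB.1 hG⟩)

end GB

/-- If the quotient is a finitely generated `A`-module and the ideal has a monic
Gröbner basis, then the quotient is isomorphic to `A^N` for some `N`. -/
theorem quotient_iso_pow_of_monic_groebnerBasis
    {n : ℕ} {A : Type*} [CommRing A] (m : MonomialOrder (Fin n))
    (𝔞 : Ideal (MvPolynomial (Fin n) A)) (h𝔞 : 𝔞 ≠ ⊥)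
    [Module.Finite A (MvPolynomial (Fin n) A ⧸ 𝔞)]
    (hex : ∃ G : Finset (MvPolynomial (Fin n) A),
      GB.IsGrobnerBasis m 𝔞 G ∧ GB.IsMonic m G) :
    ∃ N : ℕ, Nonempty ((MvPolynomial (Fin n) A ⧸ 𝔞) ≃ₗ[A] (Fin N → A)) := by
  obtain ⟨G, hGB, hG⟩ := hex
  have hA : Nontrivial A := by
    by_contra h
    rw [not_nontrivial_iff_subsingleton] at h
    exact h𝔞 (Subsingleton.elim _ _)
  let b := GB.quotientBasis hGB hG
  have := Module.Finite.finite_basis b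
  obtain ⟨N, ⟨e⟩⟩ := Finite.exists_equiv_fin (GB.standardMonomials m G)
  exact ⟨N, ⟨(b.reindex e).equivFun⟩⟩
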